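/- arXiv:2411.08480 — 3 statements merged into one kernel-verified Lean document; each statement's English description precedes it below -/
import Mathlib

section
/- Let α > 1 and β > 0, and set p = α/(α+1). Suppose R : ℕ → ℝ satisfies R(n) = p·R(n+1) + (1−p)·R(n−1) for all n ≥ 2, the boundary condition R(1) = (α/(α+β))·R(2), and R(n) → 1 as n → ∞. Then R(1) = (α−1)/(α+β−1). -/
open Filter

theorem escape_probability_at_one (α β : ℝ) (hα : 1 < α) (hβ : 0 < β)
    (R : ℕ → ℝ)
    (hrec : ∀ n : ℕ, 2 ≤ n →
      R n = (α / (α + 1)) * R (n + 1) + (1 - α / (α + 1)) * R (n - 1))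
    (hbd : R 1 = (α / (α + β)) * R 2)
    (hlim : Tendsto R atTop (nhds 1)) :
    R 1 = (α - 1) / (α + β - 1) := by
  have hα1 : α + 1 ≠ 0 := by linarith
  have hαβ : α + β ≠ 0 := by linarith
  have hαβ1 : α + β - 1 ≠ 0 := by linarith
  -- The recurrence makes `α * R (n + 1) - R n` constant; its value is read off at infinity.
  have hconst : ∀ n : ℕ, α * R (n + 2) - R (n + 1) = α * R 2 - R 1 := by
    intro n
    induction n with
    | zero => rfl
    | succ k ih =>
      have h := hrec (k + 2) (by omega)
      rw [show k + 2 - 1 = k + 1 by omega] at h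
      field_simp at h
      rw [← ih]
      linarith
  have hlim' : Tendsto (fun n : ℕ => α * R (n + 2) - R (n + 1)) atTop (nhds (α * 1 - 1)) :=
    (((tendsto_add_atTop_iff_nat 2).2 hlim).const_mul α).sub
      ((tendsto_add_atTop_iff_nat 1).2 hlim)
  simp only [hconst] at hlim'
  have hval : α * R 2 - R 1 = α * 1 - 1 := tendsto_nhds_unique tendsto_const_nhds hlim'
  field_simp at hbd
  rw [eq_div_iff hαβ1]
  linarith
end

section
/- Let α > 1, β > 0, 0 < ρ_L ≤ 1 and n ≥ 1. Then the series ∑_{k=n}^{∞} ρ_L·(1−ρ_L)^{k−n}·(1 − (β/(α+β−1))·α^{1−k}) converges and its sum equals 1 − ρ_L·β·α^{2−n} / ((α+β−1)(α+ρ_L−1)). -/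
theorem right_escape_probability_geometric (α β ρL : ℝ) (n : ℕ)
    (hα : 1 < α) (hβ : 0 < β) (hρL : 0 < ρL) (hρL1 : ρL ≤ 1) (hn : 1 ≤ n) :
    HasSum
      (fun j : ℕ =>
        ρL * (1 - ρL) ^ j *
          (1 - (β / (α + β - 1)) * α ^ ((1 : ℤ) - ((n : ℤ) + (j : ℤ)))))
      (1 - ρL * β * α ^ ((2 : ℤ) - (n : ℤ)) /
        ((α + β - 1) * (α + ρL - 1))) := by
  have hα0 : α ≠ 0 := by positivity
  have hαβ : α + β - 1 ≠ 0 := by linarith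
  have hαρ : α + ρL - 1 ≠ 0 := by linarith
  have hratio : (1 - ρL) / α < 1 := by
    rw [div_lt_one (by linarith)]
    linarith
  have hmass := (hasSum_geometric_of_lt_one (r := 1 - ρL) (by linarith) (by linarith)).mul_left ρL
  have hloss := (hasSum_geometric_of_lt_one (r := (1 - ρL) / α)
    (div_nonneg (by linarith) (by linarith)) hratio).mul_left
      (ρL * (β / (α + β - 1)) * α ^ ((1 : ℤ) - (n : ℤ)))
  have hdiff : HasSum (fun j : ℕ => ρL * (1 - ρL) ^ j -
      ρL * (β / (α + β - 1)) * α ^ ((1 : ℤ) - (n : ℤ)) * ((1 - ρL) / α) ^ j) _ :=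
    hmass.sub hloss
  convert hdiff using 1
  · funext j
    rw [← sub_sub, zpow_sub₀ hα0 _ (j : ℤ), zpow_natCast, div_pow]
    ring
  · have hpow : α ^ ((2 : ℤ) - (n : ℤ)) = α ^ ((1 : ℤ) - (n : ℤ)) * α := by
      rw [← zpow_add_one₀ hα0]
      congr 1
      ring
    have hinv : (1 - (1 - ρL) / α)⁻¹ = α / (α + ρL - 1) := by
      rw [one_sub_div hα0, inv_div]
      congr 1
      ring
    rw [hpow, hinv, sub_sub_cancel, mul_inv_cancel₀ hρL.ne']
    field_simp
end

section
/- Let α > 1 and β > 0, and let (X_k)_{k≥0} be the Markov chain on ℤ defined in the context, started at X_0 = n with n ≥ 1. Then the probability that X_k ≥ 1 for all k ≥ 0 equals 1 − (β/(α+β−1))·α^{1−n}. In particular, for n = 1 it equals (α−1)/(α+β−1). -/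
open MeasureTheory

/-- One-step transition probabilities of the distance chain between the
impurity (jump rate `α`, overtaking rate `β`) and the rightmost particle:
from `m ≥ 2` it moves to `m + 1` with probability `α/(α+1)` and to `m - 1`
with probability `1/(α+1)`; from `1` it moves to `2` with probability
`α/(α+β)` and to `-1` with probability `β/(α+β)`; states `m ≤ 0` are
absorbing. -/
noncomputable def distanceKernel (α β : ℝ) (m m' : ℤ) : ℝ :=
  if 2 ≤ m then
    (if m' = m + 1 then α / (α + 1) else if m' = m - 1 then 1 / (α + 1) else 0)
  else if m = 1 then
    (if m' = 2 then α / (α + β) else if m' = -1 then β / (α + β) else 0)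
  else
    (if m' = m then 1 else 0)

/-- `μ` is the law of the chain started at `n`, characterized by its values on
cylinder sets. -/
def IsChainLaw (α β : ℝ) (n : ℕ) (μ : Measure (ℕ → ℤ)) : Prop :=
  ∀ (k : ℕ) (a : ℕ → ℤ),
    μ {ω | ∀ i ≤ k, ω i = a i} =
      (if a 0 = (n : ℤ) then 1 else 0) *
        ENNReal.ofReal (∏ i ∈ Finset.range k, distanceKernel α β (a i) (a (i + 1)))

open Filter Topology
open scoped ENNReal

section DistanceChain

variable {α β : ℝ}

lemma distanceKernel_nonneg (hα : 0 < α) (hβ : 0 < β) (m m' : ℤ) :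
    0 ≤ distanceKernel α β m m' := by
  unfold distanceKernel
  split_ifs <;> positivity

/-- The action of the transition kernel on functions. -/
noncomputable def distanceStep (α β : ℝ) (g : ℤ → ℝ) (m : ℤ) : ℝ :=
  if 2 ≤ m then α / (α + 1) * g (m + 1) + 1 / (α + 1) * g (m - 1)
  else if m = 1 then α / (α + β) * g 2 + β / (α + β) * g (-1)
  else g m

lemma tsum_distanceKernel_mul (hα : 0 < α) (hβ : 0 < β) {g : ℤ → ℝ} (hg : ∀ m, 0 ≤ g m)
    (m : ℤ) :
    ∑' m', ENNReal.ofReal (distanceKernel α β m m') * ENNReal.ofReal (g m') =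
      ENNReal.ofReal (distanceStep α β g m) := by
  have hmul : ∀ m', ENNReal.ofReal (distanceKernel α β m m') * ENNReal.ofReal (g m') =
      ENNReal.ofReal (distanceKernel α β m m' * g m') := fun m' ↦
    (ENNReal.ofReal_mul (distanceKernel_nonneg hα hβ m m')).symm
  have hnn : ∀ m', 0 ≤ distanceKernel α β m m' * g m' := fun m' ↦
    mul_nonneg (distanceKernel_nonneg hα hβ m m') (hg m')
  simp_rw [hmul]
  have key : ∀ s : Finset ℤ, (∀ m' ∉ s, distanceKernel α β m m' = 0) →
      ∑ m' ∈ s, distanceKernel α β m m' * g m' = distanceStep α β g m →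
      ∑' m', ENNReal.ofReal (distanceKernel α β m m' * g m') =
        ENNReal.ofReal (distanceStep α β g m) := by
    intro s hs hsum
    rw [tsum_eq_sum (s := s) (fun m' hm' ↦ by simp [hs m' hm']),
      ← ENNReal.ofReal_sum_of_nonneg (fun m' _ ↦ hnn m'), hsum]
  by_cases h2 : 2 ≤ m
  · refine key {m + 1, m - 1} (fun m' hm' ↦ ?_) ?_
    · simp only [Finset.mem_insert, Finset.mem_singleton, not_or] at hm'
      simp [distanceKernel, h2, hm'.1, hm'.2]
    · rw [Finset.sum_pair (by lia)]
      have : m - 1 ≠ m + 1 := by lia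
      simp [distanceKernel, distanceStep, h2, this]
  by_cases h1 : m = 1
  · subst h1
    refine key {2, -1} (fun m' hm' ↦ ?_) ?_
    · simp only [Finset.mem_insert, Finset.mem_singleton, not_or] at hm'
      simp [distanceKernel, hm'.1, hm'.2]
    · rw [Finset.sum_pair (by lia)]
      simp [distanceKernel, distanceStep]
  · refine key {m} (fun m' hm' ↦ ?_) ?_
    · simp only [Finset.mem_singleton] at hm'
      simp [distanceKernel, h2, h1, hm']
    · simp [distanceKernel, distanceStep, h2, h1]

variable {n : ℕ} {μ : Measure (ℕ → ℤ)}

lemma IsChainLaw.measure_cylinder_succ (hμ : IsChainLaw α β n μ) (hα : 0 < α) (hβ : 0 < β)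
    (k : ℕ) (a : ℕ → ℤ) :
    μ {ω | ∀ i ≤ k + 1, ω i = a i} =
      μ {ω | ∀ i ≤ k, ω i = a i} * ENNReal.ofReal (distanceKernel α β (a k) (a (k + 1))) := by
  rw [hμ, hμ, Finset.prod_range_succ, ENNReal.ofReal_mul, mul_assoc]
  exact Finset.prod_nonneg fun i _ ↦ distanceKernel_nonneg hα hβ _ _

lemma IsChainLaw.measure_step (hμ : IsChainLaw α β n μ) (hα : 0 < α) (hβ : 0 < β)
    (k : ℕ) (m m' : ℤ) :
    μ {ω | ω k = m ∧ ω (k + 1) = m'} =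
      μ {ω | ω k = m} * ENNReal.ofReal (distanceKernel α β m m') := by
  let f : (ℕ → ℤ) → (Fin (k + 1) → ℤ) := fun ω i ↦ ω i
  have hf : Measurable f := by fun_prop
  let s : Set (Fin (k + 1) → ℤ) := {b | b (Fin.last k) = m}
  have hs : f ⁻¹' s = {ω | ω k = m} := by ext ω; simp [f, s]
  have hsum (ν : Measure (ℕ → ℤ)) : ν {ω | ω k = m} = ∑' b : s, ν (f ⁻¹' {↑b}) := by
    rw [tsum_measure_preimage_singleton s.to_countable
      (fun b _ ↦ hf (measurableSet_singleton b)), hs]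
  have hm' : MeasurableSet {ω : ℕ → ℤ | ω (k + 1) = m'} :=
    measurableSet_eq_fun (measurable_pi_apply (k + 1)) measurable_const
  have h1 : μ {ω | ω k = m ∧ ω (k + 1) = m'} =
      (μ.restrict {ω | ω (k + 1) = m'}) {ω | ω k = m} := by
    rw [Measure.restrict_apply' hm']; rfl
  rw [h1, hsum, hsum μ, ← ENNReal.tsum_mul_right]
  refine tsum_congr fun ⟨b, hb⟩ ↦ ?_
  rw [Measure.restrict_apply' hm']
  let a : ℕ → ℤ := fun i ↦ if h : i < k + 1 then b ⟨i, h⟩ else m'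
  have ha (i : ℕ) (h : i < k + 1) : a i = b ⟨i, h⟩ := dif_pos h
  have hak : a k = m := (ha k k.lt_succ_self).trans hb
  have hak' : a (k + 1) = m' := by simp [a]
  have hcyl : f ⁻¹' {b} = {ω | ∀ i ≤ k, ω i = a i} := by
    ext ω
    simp only [Set.mem_preimage, Set.mem_singleton_iff, Set.mem_ofPred_eq, funext_iff]
    constructor
    · intro h i hi
      rw [ha i (Nat.lt_succ_of_le hi)]
      exact h ⟨i, Nat.lt_succ_of_le hi⟩
    · intro h i
      rw [← ha i i.isLt]
      exact h i (Nat.le_of_lt_succ i.isLt)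
  have hstep := hμ.measure_cylinder_succ hα hβ k a
  rw [hak, hak', ← hcyl] at hstep
  rw [← hstep, hcyl]
  congr 1
  ext ω
  simp only [Set.mem_inter_iff, Set.mem_ofPred_eq]
  constructor
  · rintro ⟨h, h'⟩ i hi
    rcases Nat.le_succ_iff.1 hi with hi | rfl
    · exact h i hi
    · rw [h', hak']
  · exact fun h ↦ ⟨fun i hi ↦ h i (by lia), by rw [h _ le_rfl, hak']⟩

/-- The expectation of `g` at time `k`, as a sum over states. -/
noncomputable def stateSum (μ : Measure (ℕ → ℤ)) (k : ℕ) (g : ℤ → ℝ) : ℝ≥0∞ :=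
  ∑' m, μ {ω | ω k = m} * ENNReal.ofReal (g m)

lemma stateSum_mono {k : ℕ} {g g' : ℤ → ℝ} (h : ∀ m, g m ≤ g' m) :
    stateSum μ k g ≤ stateSum μ k g' :=
  ENNReal.tsum_le_tsum fun m ↦ mul_le_mul_right (ENNReal.ofReal_le_ofReal (h m)) _

lemma stateSum_add {k : ℕ} {g g' : ℤ → ℝ} (hg : ∀ m, 0 ≤ g m) (hg' : ∀ m, 0 ≤ g' m) :
    stateSum μ k (fun m ↦ g m + g' m) = stateSum μ k g + stateSum μ k g' := by
  simp only [stateSum, ENNReal.ofReal_add (hg _) (hg' _), mul_add, ENNReal.tsum_add]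

lemma stateSum_const_mul {k : ℕ} {c : ℝ} (hc : 0 ≤ c) (g : ℤ → ℝ) :
    stateSum μ k (fun m ↦ c * g m) = ENNReal.ofReal c * stateSum μ k g := by
  simp only [stateSum, ENNReal.ofReal_mul hc, ← ENNReal.tsum_mul_left]
  exact tsum_congr fun m ↦ mul_left_comm _ _ _

lemma stateSum_indicator (k : ℕ) (s : Set ℤ) :
    stateSum μ k (s.indicator 1) = μ {ω | ω k ∈ s} := by
  have hk (b : ℤ) : MeasurableSet ((fun ω : ℕ → ℤ ↦ ω k) ⁻¹' {b}) :=
    measurable_pi_apply k (measurableSet_singleton b)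
  have := tsum_measure_preimage_singleton (μ := μ) (f := fun ω : ℕ → ℤ ↦ ω k)
    s.to_countable (fun b _ ↦ hk b)
  rw [tsum_subtype s (fun b ↦ μ ((fun ω : ℕ → ℤ ↦ ω k) ⁻¹' {b}))] at this
  refine Eq.trans (tsum_congr fun m ↦ ?_) this
  by_cases hm : m ∈ s
  · simp only [Set.indicator_of_mem hm, Pi.one_apply, ENNReal.ofReal_one, mul_one]
    rfl
  · simp [hm]

lemma IsChainLaw.stateSum_zero (hμ : IsChainLaw α β n μ) (g : ℤ → ℝ) :
    stateSum μ 0 g = ENNReal.ofReal (g n) := by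
  have h (m : ℤ) : μ {ω | ω 0 = m} = if m = n then 1 else 0 := by
    simpa using hμ 0 (fun _ ↦ m)
  simp [stateSum, h]

lemma IsChainLaw.stateSum_succ (hμ : IsChainLaw α β n μ) (hα : 0 < α) (hβ : 0 < β)
    (k : ℕ) {g : ℤ → ℝ} (hg : ∀ m, 0 ≤ g m) :
    stateSum μ (k + 1) g = stateSum μ k (distanceStep α β g) := by
  have hk (b : ℤ) : MeasurableSet ((fun ω : ℕ → ℤ ↦ ω k) ⁻¹' {b}) :=
    measurable_pi_apply k (measurableSet_singleton b)
  have h (m' : ℤ) : μ {ω | ω (k + 1) = m'} =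
      ∑' m, μ {ω | ω k = m} * ENNReal.ofReal (distanceKernel α β m m') := by
    have hm' : MeasurableSet {ω : ℕ → ℤ | ω (k + 1) = m'} :=
      measurableSet_eq_fun (measurable_pi_apply (k + 1)) measurable_const
    have := tsum_measure_preimage_singleton (μ := μ.restrict {ω | ω (k + 1) = m'})
      (f := fun ω : ℕ → ℤ ↦ ω k) Set.countable_univ (fun b _ ↦ hk b)
    rw [Set.preimage_univ, Measure.restrict_apply_univ,
      tsum_univ (fun b ↦ (μ.restrict {ω | ω (k + 1) = m'}) ((fun ω : ℕ → ℤ ↦ ω k) ⁻¹' {b}))]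
      at this
    rw [← this]
    refine tsum_congr fun m ↦ ?_
    rw [Measure.restrict_apply' hm', ← hμ.measure_step hα hβ]
    rfl
  simp only [stateSum, h, ← ENNReal.tsum_mul_right, mul_assoc]
  rw [ENNReal.tsum_comm]
  refine tsum_congr fun m ↦ ?_
  rw [ENNReal.tsum_mul_left, tsum_distanceKernel_mul hα hβ hg]

lemma IsChainLaw.stateSum_of_harmonic (hμ : IsChainLaw α β n μ) (hα : 0 < α) (hβ : 0 < β)
    {g : ℤ → ℝ} (hg : ∀ m, 0 ≤ g m) (h : ∀ m, distanceStep α β g m = g m) (k : ℕ) :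
    stateSum μ k g = ENNReal.ofReal (g n) := by
  induction k with
  | zero => exact hμ.stateSum_zero g
  | succ k ih => rw [hμ.stateSum_succ hα hβ k hg, funext h, ih]

lemma IsChainLaw.stateSum_le_pow (hμ : IsChainLaw α β n μ) (hα : 0 < α) (hβ : 0 < β)
    {g : ℤ → ℝ} (hg : ∀ m, 0 ≤ g m) {ρ : ℝ} (hρ : 0 ≤ ρ)
    (h : ∀ m, distanceStep α β g m ≤ ρ * g m) (k : ℕ) :
    stateSum μ k g ≤ ENNReal.ofReal ρ ^ k * ENNReal.ofReal (g n) := by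
  induction k with
  | zero => simp [hμ.stateSum_zero g]
  | succ k ih =>
    rw [hμ.stateSum_succ hα hβ k hg, pow_succ', mul_assoc]
    refine (stateSum_mono h).trans ?_
    rw [stateSum_const_mul hρ]
    gcongr

lemma IsChainLaw.ae_pos_of_pos_succ (hμ : IsChainLaw α β n μ) (hα : 0 < α) (hβ : 0 < β) :
    ∀ᵐ ω ∂μ, ∀ k, 1 ≤ ω (k + 1) → 1 ≤ ω k := by
  have h : ∀ᵐ ω ∂μ, ∀ k : ℕ, ∀ m m' : ℤ, m ≤ 0 → 1 ≤ m' → ¬ (ω k = m ∧ ω (k + 1) = m') := by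
    simp only [ae_all_iff]
    intro k m m' hm hm'
    have hK : distanceKernel α β m m' = 0 := by
      simp [distanceKernel, show ¬ 2 ≤ m by lia, show m ≠ 1 by lia, show m' ≠ m by lia]
    have := hμ.measure_step hα hβ k m m'
    rw [hK, ENNReal.ofReal_zero, mul_zero] at this
    rw [ae_iff]
    simpa only [not_not] using this
  filter_upwards [h] with ω hω k hk
  by_contra hlt
  exact hω k _ _ (by lia) hk ⟨rfl, rfl⟩

lemma IsChainLaw.tendsto_measure_pos [IsProbabilityMeasure μ] (hμ : IsChainLaw α β n μ)
    (hα : 0 < α) (hβ : 0 < β) :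
    Tendsto (fun k ↦ μ {ω | 1 ≤ ω k}) atTop (𝓝 (μ {ω | ∀ k, 1 ≤ ω k})) := by
  have hmeas (k : ℕ) : MeasurableSet {ω : ℕ → ℤ | ∀ i ≤ k, 1 ≤ ω i} := by
    simp only [Set.ofPred_forall]
    exact .iInter fun i ↦ .iInter fun _ ↦ measurable_pi_apply i measurableSet_Ici
  have hlim := tendsto_measure_iInter_atTop (μ := μ)
    (s := fun k ↦ {ω : ℕ → ℤ | ∀ i ≤ k, 1 ≤ ω i}) (fun k ↦ (hmeas k).nullMeasurableSet)
    (fun k l hkl ω hω i hi ↦ hω i (hi.trans hkl)) ⟨0, measure_ne_top _ _⟩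
  have hInter : ⋂ k, {ω : ℕ → ℤ | ∀ i ≤ k, 1 ≤ ω i} = {ω | ∀ k, 1 ≤ ω k} := by
    ext ω
    simp only [Set.mem_iInter, Set.mem_ofPred_eq]
    exact ⟨fun h k ↦ h k k le_rfl, fun h k i _ ↦ h i⟩
  rw [hInter] at hlim
  refine hlim.congr fun k ↦ measure_congr ?_
  filter_upwards [hμ.ae_pos_of_pos_succ hα hβ] with ω hω
  refine propext ⟨fun h ↦ h k le_rfl, fun h i hi ↦ ?_⟩
  exact Nat.decreasingInduction (motive := fun j _ ↦ 1 ≤ ω j) (fun j _ hj ↦ hω j hj) h hi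

/-- The escape probability as a function of the initial state. -/
noncomputable def escapeFun (α β : ℝ) (m : ℤ) : ℝ :=
  if 1 ≤ m then 1 - β / (α + β - 1) * α ^ (1 - m) else 0

lemma escapeFun_nonneg (hα : 1 < α) (hβ : 0 < β) (m : ℤ) : 0 ≤ escapeFun α β m := by
  unfold escapeFun
  split_ifs with hm
  · have h1 : β / (α + β - 1) ≤ 1 := (div_le_one (by linarith)).2 (by linarith)
    have h2 : α ^ (1 - m) ≤ 1 := zpow_le_one_of_nonpos₀ hα.le (by lia)
    have h3 : 0 ≤ α ^ (1 - m) := by positivity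
    have := mul_le_one₀ h1 h3 h2
    linarith
  · rfl

lemma distanceStep_escapeFun (hα : 1 < α) (hβ : 0 < β) (m : ℤ) :
    distanceStep α β (escapeFun α β) m = escapeFun α β m := by
  have hα0 : α ≠ 0 := by positivity
  have h1 : α + β - 1 ≠ 0 := by linarith
  have h2 : α + 1 ≠ 0 := by linarith
  have h3 : α + β ≠ 0 := by linarith
  unfold distanceStep
  split_ifs with hm2 hm1
  · have e1 : α ^ (1 - (m + 1)) = α ^ (1 - m) / α := by
      rw [div_eq_mul_inv, ← zpow_sub_one₀ hα0]; congr 1; ring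
    have e2 : α ^ (1 - (m - 1)) = α ^ (1 - m) * α := by
      rw [← zpow_add_one₀ hα0]; congr 1; ring
    simp only [escapeFun, show 1 ≤ m + 1 by lia, show 1 ≤ m - 1 by lia, show 1 ≤ m by lia,
      if_true, e1, e2]
    field_simp
    ring
  · subst hm1
    have e : α ^ (1 - 2 : ℤ) = α⁻¹ := by norm_num
    simp only [escapeFun, e]
    norm_num
    field_simp
    ring
  · rfl

/-- The powers of `r`, killed at the nonpositive states. -/
noncomputable def killedPow (r : ℝ) (m : ℤ) : ℝ := if 1 ≤ m then r ^ m else 0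

lemma killedPow_nonneg {r : ℝ} (hr : 0 ≤ r) (m : ℤ) : 0 ≤ killedPow r m := by
  unfold killedPow
  split_ifs <;> positivity

lemma distanceStep_killedPow_le {r ρ : ℝ} (hα : 0 < α) (hβ : 0 < β) (hr : 0 < r)
    (h1 : α * r ^ 2 + 1 ≤ ρ * (α + 1) * r) (h2 : α * r ≤ ρ * (α + β)) (m : ℤ) :
    distanceStep α β (killedPow r) m ≤ ρ * killedPow r m := by
  unfold distanceStep
  split_ifs with hm2 hm1
  · simp only [killedPow, show 1 ≤ m + 1 by lia, show 1 ≤ m - 1 by lia, show 1 ≤ m by lia,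
      if_true, zpow_add_one₀ hr.ne', zpow_sub_one₀ hr.ne']
    have hx : 0 < r ^ m := by positivity
    have : α / (α + 1) * (r ^ m * r) + 1 / (α + 1) * (r ^ m * r⁻¹) =
        (α * r ^ 2 + 1) / ((α + 1) * r) * r ^ m := by
      field_simp
    rw [this]
    gcongr
    rw [div_le_iff₀ (by positivity)]
    linarith
  · subst hm1
    have e : r ^ (2 : ℤ) = r * r := by rw [zpow_ofNat]; ring
    simp only [killedPow, e]
    norm_num
    rw [← mul_assoc]
    gcongr
    rw [div_mul_eq_mul_div, div_le_iff₀ (by positivity)]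
    exact h2
  · simp [killedPow, show ¬ 1 ≤ m by lia]

lemma exists_rate (hα : 1 < α) (hβ : 0 < β) :
    ∃ r ρ : ℝ, 0 < r ∧ α⁻¹ ≤ r ∧ 0 ≤ ρ ∧ ρ < 1 ∧ α * r ^ 2 + 1 ≤ ρ * (α + 1) * r ∧
      α * r ≤ ρ * (α + β) := by
  have hα0 : 0 < α := by linarith
  have hr : 0 < 2 / (α + 1) := by positivity
  have hr1 : 2 / (α + 1) < 1 := (div_lt_one (by linarith)).2 (by linarith)
  set r := 2 / (α + 1) with hrdef
  have hra : (α + 1) * r = 2 := by rw [hrdef]; field_simp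
  have hαr : 1 < α * r := by linarith
  refine ⟨r, max ((α * r ^ 2 + 1) / ((α + 1) * r)) (α * r / (α + β)), hr, ?_, ?_, ?_, ?_, ?_⟩
  · rw [inv_le_iff_one_le_mul₀ hα0]; linarith
  · exact le_max_of_le_right (by positivity)
  · refine max_lt ?_ ?_
    · rw [div_lt_one (by positivity)]
      nlinarith
    · rw [div_lt_one (by positivity)]
      nlinarith
  · rw [mul_assoc, ← div_le_iff₀ (by positivity)]
    exact le_max_left _ _
  · rw [← div_le_iff₀ (by positivity)]
    exact le_max_right _ _

lemma indicator_pos_eq_escapeFun_add (hα : α ≠ 0) (m : ℤ) :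
    (Set.Ici (1 : ℤ)).indicator (1 : ℤ → ℝ) m =
      escapeFun α β m + β / (α + β - 1) * α * killedPow α⁻¹ m := by
  by_cases hm : 1 ≤ m
  · simp only [Set.indicator_of_mem (Set.mem_Ici.2 hm), Pi.one_apply, escapeFun, killedPow, hm,
      if_true, zpow_sub₀ hα, zpow_one, inv_zpow]
    ring
  · simp [escapeFun, killedPow, hm]

lemma killedPow_mono {r r' : ℝ} (hr : 0 ≤ r) (h : r ≤ r') (m : ℤ) :
    killedPow r m ≤ killedPow r' m := by
  unfold killedPow
  split_ifs with hm
  · lift m to ℕ using by lia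
    simp only [zpow_natCast]
    gcongr
  · rfl

lemma IsChainLaw.measure_escape [IsProbabilityMeasure μ] (hμ : IsChainLaw α β n μ)
    (hα : 1 < α) (hβ : 0 < β) :
    μ {ω | ∀ k, 1 ≤ ω k} = ENNReal.ofReal (escapeFun α β n) := by
  have hα0 : 0 < α := by linarith
  obtain ⟨r, ρ, hr, hαr, hρ, hρ1, h1, h2⟩ := exists_rate hα hβ
  have hc : 0 ≤ β / (α + β - 1) * α :=
    mul_nonneg (div_nonneg hβ.le (by linarith)) hα0.le
  have hdecomp (k : ℕ) : μ {ω | 1 ≤ ω k} = ENNReal.ofReal (escapeFun α β n) +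
      ENNReal.ofReal (β / (α + β - 1) * α) * stateSum μ k (killedPow α⁻¹) := by
    rw [← hμ.stateSum_of_harmonic hα0 hβ (escapeFun_nonneg hα hβ)
      (distanceStep_escapeFun hα hβ) k, ← stateSum_const_mul hc, ← stateSum_add
      (escapeFun_nonneg hα hβ) (fun m ↦ mul_nonneg hc (killedPow_nonneg (by positivity) m)),
      ← funext (indicator_pos_eq_escapeFun_add hα0.ne'), stateSum_indicator]
    rfl
  have hbound (k : ℕ) : stateSum μ k (killedPow α⁻¹) ≤
      ENNReal.ofReal ρ ^ k * ENNReal.ofReal (killedPow r n) :=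
    (stateSum_mono (killedPow_mono (by positivity) hαr)).trans <|
      hμ.stateSum_le_pow hα0 hβ (killedPow_nonneg hr.le) hρ
        (distanceStep_killedPow_le hα0 hβ hr h1 h2) k
  have hpow : Tendsto (fun k ↦ ENNReal.ofReal ρ ^ k * ENNReal.ofReal (killedPow r n))
      atTop (𝓝 0) := by
    simpa using ENNReal.Tendsto.mul_const
      (ENNReal.tendsto_pow_atTop_nhds_zero_of_lt_one (ENNReal.ofReal_lt_one.2 hρ1))
      (Or.inr (ENNReal.ofReal_ne_top (r := killedPow r n)))
  have hzero : Tendsto (fun k ↦ stateSum μ k (killedPow α⁻¹)) atTop (𝓝 0) :=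
    tendsto_of_tendsto_of_tendsto_of_le_of_le tendsto_const_nhds hpow (fun _ ↦ zero_le) hbound
  have hlim : Tendsto (fun k ↦ μ {ω | 1 ≤ ω k}) atTop
      (𝓝 (ENNReal.ofReal (escapeFun α β n))) := by
    simp_rw [hdecomp]
    simpa using tendsto_const_nhds.add
      (ENNReal.Tendsto.const_mul hzero (Or.inr ENNReal.ofReal_ne_top))
  exact tendsto_nhds_unique (hμ.tendsto_measure_pos hα0 hβ) hlim

end DistanceChain

theorem right_escape_probability (α β : ℝ) (hα : 1 < α) (hβ : 0 < β)
    (n : ℕ) (hn : 1 ≤ n) (μ : Measure (ℕ → ℤ)) [IsProbabilityMeasure μ]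
    (hμ : IsChainLaw α β n μ) :
    μ {ω | ∀ k : ℕ, 1 ≤ ω k} =
      ENNReal.ofReal (1 - (β / (α + β - 1)) * α ^ ((1 : ℤ) - (n : ℤ))) ∧
    (n = 1 → μ {ω | ∀ k : ℕ, 1 ≤ ω k} =
      ENNReal.ofReal ((α - 1) / (α + β - 1))) := by
  have hmain : μ {ω | ∀ k : ℕ, 1 ≤ ω k} =
      ENNReal.ofReal (1 - (β / (α + β - 1)) * α ^ ((1 : ℤ) - (n : ℤ))) := by
    rw [hμ.measure_escape hα hβ, escapeFun, if_pos (by exact_mod_cast hn)]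
  refine ⟨hmain, ?_⟩
  rintro rfl
  rw [hmain]
  have : α + β - 1 ≠ 0 := by linarith
  congr 1
  norm_num
  field_simp
  ring
end
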